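/- There is an absolute constant C such that for every weight ω on ℝ with [ω]_{A₂} < ∞ and every I ∈ 𝒟: ∑_{J∈𝒟, J⊆I} ⟨ω^{-1/2}, h_J⟩² ⟨ω⟩_J ≤ C [ω]_{A₂}² |I|. -/

import Mathlib

open MeasureTheory ENNReal NNReal

noncomputable section

/-- The dyadic interval `[2^n k, 2^n (k+1))`, encoded by the pair `p = (n, k)`. -/
def dyad (p : ℤ × ℤ) : Set ℝ := Set.Ico ((2:ℝ) ^ p.1 * p.2) ((2:ℝ) ^ p.1 * (p.2 + 1))

/-- The length `2^n` of the dyadic interval encoded by `p = (n, k)`. -/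
def len (p : ℤ × ℤ) : ℝ := (2:ℝ) ^ p.1

/-- The left half `I₋` of the dyadic interval. -/
def lhalf (p : ℤ × ℤ) : ℤ × ℤ := (p.1 - 1, 2 * p.2)

/-- The right half `I₊` of the dyadic interval. -/
def rhalf (p : ℤ × ℤ) : ℤ × ℤ := (p.1 - 1, 2 * p.2 + 1)

/-- The average `⟨f⟩_I = |I|⁻¹ ∫_I f` over the dyadic interval `p`. -/
def avg (f : ℝ → ℝ) (p : ℤ × ℤ) : ℝ := (len p)⁻¹ * ∫ x in dyad p, f x

/-- The Haar function `h_I = |I|^{-1/2} (1_{I₋} - 1_{I₊})`. -/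
def haar (p : ℤ × ℤ) : ℝ → ℝ := fun x =>
  (Real.sqrt (len p))⁻¹ *
    ((dyad (lhalf p)).indicator (fun _ => (1:ℝ)) x -
      (dyad (rhalf p)).indicator (fun _ => (1:ℝ)) x)

/-- The Haar coefficient `⟨f, h_I⟩ = ∫ f h_I`. -/
def haarCoeff (f : ℝ → ℝ) (p : ℤ × ℤ) : ℝ := ∫ x, f x * haar p x

/-- The A₂ characteristic `[ω]_{A₂} = sup_I ⟨ω⟩_I ⟨ω⁻¹⟩_I`, valued in `ℝ≥0∞`. -/
def A2 (ω : ℝ → ℝ) : ℝ≥0∞ :=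
  ⨆ p : ℤ × ℤ, ENNReal.ofReal (avg ω p * avg (fun x => (ω x)⁻¹) p)

/-- `ω` is a weight: measurable, positive, with `ω` and `ω⁻¹` locally integrable. -/
def IsWeight (ω : ℝ → ℝ) : Prop :=
  Measurable ω ∧ (∀ x, 0 < ω x) ∧
    LocallyIntegrable ω volume ∧ LocallyIntegrable (fun x => (ω x)⁻¹) volume

/-- The measure `ω dx`. -/
def wMeasure (ω : ℝ → ℝ) : Measure ℝ := volume.withDensity fun x => ENNReal.ofReal (ω x)

/-- `ω^{1/2}`. -/
def sqrtw (ω : ℝ → ℝ) : ℝ → ℝ := fun x => Real.sqrt (ω x)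

/-- `ω^{-1/2}`. -/
def invSqrtw (ω : ℝ → ℝ) : ℝ → ℝ := fun x => (Real.sqrt (ω x))⁻¹

lemma len_pos (p : ℤ × ℤ) : 0 < len p := by
  unfold len
  positivity

lemma len_lhalf (p : ℤ × ℤ) : len (lhalf p) = len p / 2 := by
  simp only [len, lhalf]
  rw [zpow_sub_one₀ (two_ne_zero)]
  ring

lemma len_rhalf (p : ℤ × ℤ) : len (rhalf p) = len p / 2 := len_lhalf p

lemma dyad_eq (p : ℤ × ℤ) : dyad p = Set.Ico (len p * p.2) (len p * (p.2 + 1)) := rfl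

lemma dyad_lhalf (p : ℤ × ℤ) :
    dyad (lhalf p) = Set.Ico (len p * p.2) (len p * p.2 + len p / 2) := by
  rw [dyad_eq, len_lhalf]
  simp only [lhalf]
  push_cast
  congr 1 <;> ring

lemma dyad_rhalf (p : ℤ × ℤ) :
    dyad (rhalf p) = Set.Ico (len p * p.2 + len p / 2) (len p * (p.2 + 1)) := by
  rw [dyad_eq, len_rhalf]
  simp only [rhalf]
  push_cast
  congr 1 <;> ring

lemma measurableSet_dyad (p : ℤ × ℤ) : MeasurableSet (dyad p) := measurableSet_Ico

lemma volume_real_dyad (p : ℤ × ℤ) : volume.real (dyad p) = len p := by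
  have := len_pos p
  rw [dyad_eq, Real.volume_real_Ico_of_le (by nlinarith)]
  ring

lemma dyad_lhalf_union_rhalf (p : ℤ × ℤ) : dyad (lhalf p) ∪ dyad (rhalf p) = dyad p := by
  have := len_pos p
  rw [dyad_lhalf, dyad_rhalf, dyad_eq, Set.Ico_union_Ico_eq_Ico] <;> nlinarith

lemma disjoint_dyad_lhalf_rhalf (p : ℤ × ℤ) : Disjoint (dyad (lhalf p)) (dyad (rhalf p)) := by
  rw [dyad_lhalf, dyad_rhalf]
  exact Set.Ico_disjoint_Ico_same

lemma MeasureTheory.LocallyIntegrable.integrableOn_dyad {f : ℝ → ℝ}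
    (hf : LocallyIntegrable f volume) (p : ℤ × ℤ) : IntegrableOn f (dyad p) :=
  (hf.integrableOn_isCompact isCompact_Icc).mono_set Set.Ico_subset_Icc_self

lemma setIntegral_dyad (f : ℝ → ℝ) (p : ℤ × ℤ) : ∫ x in dyad p, f x = len p * avg f p := by
  rw [avg, mul_inv_cancel_left₀ (len_pos p).ne']

lemma avg_eq_half_add {f : ℝ → ℝ} (hf : LocallyIntegrable f volume) (p : ℤ × ℤ) :
    avg f p = (avg f (lhalf p) + avg f (rhalf p)) / 2 := by
  have h := setIntegral_union (disjoint_dyad_lhalf_rhalf p) (measurableSet_dyad _)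
    (hf.integrableOn_dyad (lhalf p)) (hf.integrableOn_dyad (rhalf p))
  rw [dyad_lhalf_union_rhalf] at h
  simp only [setIntegral_dyad, len_lhalf, len_rhalf] at h
  have := len_pos p
  apply mul_left_cancel₀ this.ne'
  linarith

lemma avg_pos {f : ℝ → ℝ} (hf : LocallyIntegrable f volume) (h0 : ∀ x, 0 < f x) (p : ℤ × ℤ) :
    0 < avg f p := by
  refine mul_pos (inv_pos.2 (len_pos p)) ?_
  rw [setIntegral_pos_iff_support_of_nonneg_ae (ae_of_all _ fun x => (h0 x).le)
    (hf.integrableOn_dyad p)]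
  have hs : Function.support f = Set.univ := Set.eq_univ_of_forall fun x => (h0 x).ne'
  rw [hs, Set.univ_inter]
  refine pos_iff_ne_zero.2 fun h => (len_pos p).ne' ?_
  rw [← volume_real_dyad, Measure.real, h, ENNReal.toReal_zero]

lemma affine_avg_le_avg {f g : ℝ → ℝ} (hf : LocallyIntegrable f volume)
    (hg : LocallyIntegrable g volume) (p : ℤ × ℤ) {b c : ℝ} (h : ∀ x, b + c * f x ≤ g x) :
    b + c * avg f p ≤ avg g p := by
  have hc : IntegrableOn (fun x => c * f x) (dyad p) := (hf.integrableOn_dyad p).const_mul c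
  have hb : IntegrableOn (fun _ : ℝ => b) (dyad p) :=
    (continuous_const.locallyIntegrable).integrableOn_dyad p
  have := setIntegral_mono (hb.add hc) (hg.integrableOn_dyad p) h
  simp only [Pi.add_apply] at this
  rw [integral_add hb hc, setIntegral_const, integral_const_mul, volume_real_dyad,
    setIntegral_dyad, setIntegral_dyad, smul_eq_mul] at this
  refine le_of_mul_le_mul_left ?_ (len_pos p)
  linarith

lemma haarCoeff_sq {f : ℝ → ℝ} (hf : LocallyIntegrable f volume) (p : ℤ × ℤ) :
    haarCoeff f p ^ 2 = len p / 4 * (avg f (lhalf p) - avg f (rhalf p)) ^ 2 := by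
  have h : ∀ x, f x * haar p x = (Real.sqrt (len p))⁻¹ *
      ((dyad (lhalf p)).indicator f x - (dyad (rhalf p)).indicator f x) := by
    intro x
    by_cases hl : x ∈ dyad (lhalf p) <;> by_cases hr : x ∈ dyad (rhalf p) <;>
      simp [haar, hl, hr, mul_comm]
  have hl := (hf.integrableOn_dyad (lhalf p)).integrable_indicator (measurableSet_dyad _)
  have hr := (hf.integrableOn_dyad (rhalf p)).integrable_indicator (measurableSet_dyad _)
  rw [haarCoeff]
  simp only [h]
  rw [integral_const_mul, integral_sub hl hr, integral_indicator (measurableSet_dyad _),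
    integral_indicator (measurableSet_dyad _), setIntegral_dyad, setIntegral_dyad, len_lhalf,
    len_rhalf, mul_pow, inv_pow, Real.sq_sqrt (len_pos p).le]
  have := (len_pos p).ne'
  field_simp
  ring

/-- The dyadic descendants of `q` of fewer than `n` generations, `q` included. -/
def descendants : ℕ → ℤ × ℤ → Finset (ℤ × ℤ)
  | 0, _ => ∅
  | n + 1, q => insert q (descendants n (lhalf q) ∪ descendants n (rhalf q))

lemma mem_descendants_of_le {m k : ℤ} {d : ℕ} :
    ∀ {n : ℕ} {l : ℤ}, d < n → l * 2 ^ d ≤ k → k + 1 ≤ (l + 1) * 2 ^ d →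
      (m, k) ∈ descendants n (m + d, l) := by
  induction d with
  | zero =>
    intro n l hn h1 h2
    obtain ⟨n, rfl⟩ := Nat.exists_eq_add_of_lt hn
    have : k = l := by
      simp only [pow_zero, mul_one] at h1 h2
      omega
    simp [descendants, this]
  | succ d ih =>
    intro n l hn h1 h2
    obtain ⟨n, rfl⟩ : ∃ j, n = j + 1 := ⟨n - 1, by omega⟩
    have hm : m + ((d + 1 : ℕ) : ℤ) - 1 = m + d := by
      push_cast
      ring
    simp only [descendants, Finset.mem_insert, Finset.mem_union, lhalf, rhalf, hm]
    right
    rw [pow_succ] at h1 h2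
    rcases lt_or_ge k ((2 * l + 1) * 2 ^ d) with h | h
    · exact Or.inl (ih (by omega) (by linarith) (by linarith))
    · exact Or.inr (ih (by omega) h (by linarith))

lemma mem_descendants_of_dyad_subset {p q : ℤ × ℤ} (h : dyad p ⊆ dyad q) {n : ℕ}
    (hn : (q.1 - p.1).toNat < n) : p ∈ descendants n q := by
  obtain ⟨m, k⟩ := p
  obtain ⟨e, l⟩ := q
  have hp : (0 : ℝ) < 2 ^ m := by positivity
  have hlt : (2 : ℝ) ^ m * k < 2 ^ m * (k + 1) := by nlinarith
  obtain ⟨h1, h2⟩ := (Set.Ico_subset_Ico_iff hlt).1 h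
  simp only at h1 h2 hn
  have hme : m ≤ e := by
    rw [← zpow_le_zpow_iff_right₀ (one_lt_two : (1 : ℝ) < 2)]
    linarith
  obtain ⟨d, rfl⟩ := Int.le.dest hme
  rw [zpow_add₀ two_ne_zero, zpow_natCast, mul_assoc] at h1 h2
  have h1' := le_of_mul_le_mul_left h1 hp
  have h2' := le_of_mul_le_mul_left h2 hp
  refine mem_descendants_of_le (by omega) ?_ ?_
  · rw [mul_comm]
    exact_mod_cast h1'
  · rw [mul_comm]
    exact_mod_cast h2'

/-- The Bellman function method on the dyadic tree. -/
lemma sum_descendants_le {F : ℤ × ℤ → ℝ≥0∞} {B : ℤ × ℤ → ℝ≥0∞}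
    (h : ∀ q, F q + (B (lhalf q) + B (rhalf q)) ≤ B q) (n : ℕ) (q : ℤ × ℤ) :
    ∑ p ∈ descendants n q, F p ≤ B q := by
  classical
  induction n generalizing q with
  | zero => simp [descendants]
  | succ n ih =>
    have hins (s : Finset (ℤ × ℤ)) : ∑ p ∈ insert q s, F p ≤ F q + ∑ p ∈ s, F p := by
      by_cases hq : q ∈ s
      · rw [Finset.insert_eq_of_mem hq]
        exact le_add_self
      · rw [Finset.sum_insert hq]
    have huni (s t : Finset (ℤ × ℤ)) : ∑ p ∈ s ∪ t, F p ≤ ∑ p ∈ s, F p + ∑ p ∈ t, F p := by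
      rw [← Finset.sum_union_inter]
      exact le_self_add
    calc ∑ p ∈ descendants (n + 1) q, F p
        ≤ F q + (∑ p ∈ descendants n (lhalf q), F p + ∑ p ∈ descendants n (rhalf q), F p) :=
          (hins _).trans (by gcongr; exact huni _ _)
      _ ≤ F q + (B (lhalf q) + B (rhalf q)) := by
          gcongr <;> exact ih _
      _ ≤ B q := h q

lemma tsum_dyad_subset_le {F : ℤ × ℤ → ℝ≥0∞} {B : ℤ × ℤ → ℝ≥0∞}
    (h : ∀ q, F q + (B (lhalf q) + B (rhalf q)) ≤ B q) (q : ℤ × ℤ) :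
    ∑' p : {p : ℤ × ℤ // dyad p ⊆ dyad q}, F p.1 ≤ B q := by
  rw [ENNReal.tsum_eq_iSup_sum]
  refine iSup_le fun s => ?_
  let n := s.sup (fun p => (q.1 - p.1.1).toNat) + 1
  calc ∑ p ∈ s, F p.1 = ∑ p ∈ s.map (Function.Embedding.subtype _), F p := by
        rw [Finset.sum_map]
        rfl
    _ ≤ ∑ p ∈ descendants n q, F p := by
        refine Finset.sum_le_sum_of_subset fun p hp => ?_
        obtain ⟨r, hr, rfl⟩ := Finset.mem_map.1 hp
        exact mem_descendants_of_dyad_subset r.2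
          (Nat.lt_succ_of_le (Finset.le_sup (f := fun p => (q.1 - p.1.1).toNat) hr))
    _ ≤ B q := sum_descendants_le h n q

lemma log_add_log_le_two_mul_log_half_add {s t : ℝ} (hs : 0 < s) (ht : 0 < t) :
    Real.log s + Real.log t + ((s - t) / (s + t)) ^ 2 ≤ 2 * Real.log ((s + t) / 2) := by
  have hm : 0 < (s + t) / 2 := by positivity
  have hlog : Real.log (s * t / ((s + t) / 2) ^ 2) =
      Real.log s + Real.log t - 2 * Real.log ((s + t) / 2) := by
    rw [Real.log_div (by positivity) (by positivity), Real.log_mul hs.ne' ht.ne', Real.log_pow]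
    push_cast
    ring
  have hle := Real.log_le_sub_one_of_pos (show 0 < s * t / ((s + t) / 2) ^ 2 by positivity)
  have heq : s * t / ((s + t) / 2) ^ 2 - 1 = -((s - t) / (s + t)) ^ 2 := by
    field_simp
    ring
  linarith

lemma invSqrtw_pos {ω : ℝ → ℝ} (h : ∀ x, 0 < ω x) (x : ℝ) : 0 < invSqrtw ω x :=
  inv_pos.2 (Real.sqrt_pos.2 (h x))

lemma invSqrtw_sq {ω : ℝ → ℝ} (h : ∀ x, 0 < ω x) (x : ℝ) : invSqrtw ω x ^ 2 = (ω x)⁻¹ := by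
  rw [invSqrtw, inv_pow, Real.sq_sqrt (h x).le]

namespace IsWeight

variable {ω : ℝ → ℝ}

lemma locallyIntegrable_invSqrtw (hω : IsWeight ω) : LocallyIntegrable (invSqrtw ω) volume := by
  obtain ⟨hm, hpos, -, hi⟩ := hω
  have h1 : LocallyIntegrable (fun _ : ℝ => (1 : ℝ)) volume := continuous_const.locallyIntegrable
  refine (h1.add hi).mono hm.sqrt.inv.aestronglyMeasurable (ae_of_all _ fun x => ?_)
  have hf := invSqrtw_pos hpos x
  have hsq := invSqrtw_sq hpos x
  rw [Pi.add_apply, Real.norm_of_nonneg hf.le,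
    Real.norm_of_nonneg (add_nonneg zero_le_one (inv_pos.2 (hpos x)).le), ← hsq]
  nlinarith [sq_nonneg (invSqrtw ω x - 1)]

lemma avg_invSqrtw_pos (hω : IsWeight ω) (p : ℤ × ℤ) : 0 < avg (invSqrtw ω) p :=
  avg_pos hω.locallyIntegrable_invSqrtw (invSqrtw_pos hω.2.1) p

lemma avg_weight_pos (hω : IsWeight ω) (p : ℤ × ℤ) : 0 < avg ω p := avg_pos hω.2.2.1 hω.2.1 p

lemma sq_avg_invSqrtw_le (hω : IsWeight ω) (p : ℤ × ℤ) :
    avg (invSqrtw ω) p ^ 2 ≤ avg (fun x => (ω x)⁻¹) p := by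
  have := affine_avg_le_avg hω.locallyIntegrable_invSqrtw hω.2.2.2 p
    (b := -avg (invSqrtw ω) p ^ 2) (c := 2 * avg (invSqrtw ω) p) fun x => by
      rw [← invSqrtw_sq hω.2.1]
      nlinarith [sq_nonneg (invSqrtw ω x - avg (invSqrtw ω) p)]
  linarith

lemma one_le_sq_avg_invSqrtw_mul_avg (hω : IsWeight ω) (p : ℤ × ℤ) :
    1 ≤ avg (invSqrtw ω) p ^ 2 * avg ω p := by
  set a := avg (invSqrtw ω) p with ha
  have hapos : 0 < a := hω.avg_invSqrtw_pos p
  have := affine_avg_le_avg hω.locallyIntegrable_invSqrtw hω.2.2.1 p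
    (b := 3 * (a ^ 2)⁻¹) (c := -2 * (a ^ 3)⁻¹) fun x => by
      have hf := invSqrtw_pos hω.2.1 x
      have hx : ω x = (invSqrtw ω x ^ 2)⁻¹ := by rw [invSqrtw_sq hω.2.1, inv_inv]
      rw [hx]
      generalize invSqrtw ω x = f at hf
      have hdiff : (f ^ 2)⁻¹ - (3 * (a ^ 2)⁻¹ + -2 * (a ^ 3)⁻¹ * f) =
          (f - a) ^ 2 * (2 * f + a) / (f ^ 2 * a ^ 3) := by
        field_simp
        ring
      have : 0 ≤ (f - a) ^ 2 * (2 * f + a) / (f ^ 2 * a ^ 3) := by positivity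
      linarith
  rw [← ha] at this
  have hx : (a ^ 2)⁻¹ ≤ avg ω p := by
    refine le_trans (le_of_eq ?_) this
    field_simp
    norm_num
  rwa [inv_le_iff_one_le_mul₀' (by positivity)] at hx

lemma avg_mul_avg_inv_le (hA : A2 ω < ⊤) (p : ℤ × ℤ) :
    avg ω p * avg (fun x => (ω x)⁻¹) p ≤ (A2 ω).toReal :=
  (ENNReal.ofReal_le_iff_le_toReal hA.ne).1
    (le_iSup (fun p => ENNReal.ofReal (avg ω p * avg (fun x => (ω x)⁻¹) p)) p)

lemma sq_avg_invSqrtw_mul_avg_le (hω : IsWeight ω) (hA : A2 ω < ⊤) (p : ℤ × ℤ) :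
    avg (invSqrtw ω) p ^ 2 * avg ω p ≤ (A2 ω).toReal := by
  refine le_trans ?_ (avg_mul_avg_inv_le hA p)
  rw [mul_comm]
  exact mul_le_mul_of_nonneg_left (hω.sq_avg_invSqrtw_le p) (hω.avg_weight_pos p).le

lemma log_avg_halves_add_le (hω : IsWeight ω) (p : ℤ × ℤ) :
    Real.log (avg (invSqrtw ω) (lhalf p) ^ 2 * avg ω (lhalf p)) +
      Real.log (avg (invSqrtw ω) (rhalf p) ^ 2 * avg ω (rhalf p)) +
      2 * ((avg (invSqrtw ω) (lhalf p) - avg (invSqrtw ω) (rhalf p)) /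
        (2 * avg (invSqrtw ω) p)) ^ 2 ≤
    2 * Real.log (avg (invSqrtw ω) p ^ 2 * avg ω p) := by
  have hlog (r : ℤ × ℤ) : Real.log (avg (invSqrtw ω) r ^ 2 * avg ω r) =
      2 * Real.log (avg (invSqrtw ω) r) + Real.log (avg ω r) := by
    rw [Real.log_mul (pow_pos (hω.avg_invSqrtw_pos r) 2).ne' (hω.avg_weight_pos r).ne',
      Real.log_pow]
    push_cast
    ring
  have h1 := log_add_log_le_two_mul_log_half_add (hω.avg_invSqrtw_pos (lhalf p))
    (hω.avg_invSqrtw_pos (rhalf p))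
  have h2 := log_add_log_le_two_mul_log_half_add (hω.avg_weight_pos (lhalf p))
    (hω.avg_weight_pos (rhalf p))
  have ha := avg_eq_half_add hω.locallyIntegrable_invSqrtw p
  have hx := avg_eq_half_add hω.2.2.1 p
  rw [← ha, show avg (invSqrtw ω) (lhalf p) + avg (invSqrtw ω) (rhalf p) =
    2 * avg (invSqrtw ω) p by linarith] at h1
  rw [← hx] at h2
  simp only [hlog]
  linarith [sq_nonneg ((avg ω (lhalf p) - avg ω (rhalf p)) / (avg ω (lhalf p) + avg ω (rhalf p)))]

lemma haarCoeff_sq_mul_avg_add_le (hω : IsWeight ω) (hA : A2 ω < ⊤) (p : ℤ × ℤ) :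
    haarCoeff (invSqrtw ω) p ^ 2 * avg ω p +
      ((A2 ω).toReal * len (lhalf p) *
          Real.log (avg (invSqrtw ω) (lhalf p) ^ 2 * avg ω (lhalf p)) +
        (A2 ω).toReal * len (rhalf p) *
          Real.log (avg (invSqrtw ω) (rhalf p) ^ 2 * avg ω (rhalf p))) ≤
    (A2 ω).toReal * len p * Real.log (avg (invSqrtw ω) p ^ 2 * avg ω p) := by
  have hl := len_pos p
  have ha := hω.avg_invSqrtw_pos p
  have hlog := hω.log_avg_halves_add_le p
  have hQ := hω.sq_avg_invSqrtw_mul_avg_le hA p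
  rw [haarCoeff_sq hω.locallyIntegrable_invSqrtw, len_lhalf, len_rhalf]
  set Δ := avg (invSqrtw ω) (lhalf p) - avg (invSqrtw ω) (rhalf p)
  set a := avg (invSqrtw ω) p
  set Q := (A2 ω).toReal
  have hQ0 : 0 ≤ Q := ENNReal.toReal_nonneg
  have h1 : len p / 4 * Δ ^ 2 * avg ω p = len p * (Δ / (2 * a)) ^ 2 * (a ^ 2 * avg ω p) := by
    field_simp
    ring
  have h2 : len p * (Δ / (2 * a)) ^ 2 * (a ^ 2 * avg ω p) ≤ len p * (Δ / (2 * a)) ^ 2 * Q := by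
    gcongr
  have h3 := mul_le_mul_of_nonneg_left hlog (show 0 ≤ Q * len p / 2 by positivity)
  linarith

end IsWeight

/-- `∑_{J ⊆ I} ⟨ω^{-1/2}, h_J⟩² ⟨ω⟩_J ≤ C [ω]_{A₂}² |I|`. -/
theorem statement10 :
    ∃ C : ℝ≥0, ∀ ω : ℝ → ℝ, IsWeight ω → A2 ω < ⊤ → ∀ q : ℤ × ℤ,
      ∑' p : {p : ℤ × ℤ // dyad p ⊆ dyad q},
          ENNReal.ofReal ((haarCoeff (invSqrtw ω) p.1) ^ 2 * avg ω p.1) ≤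
        (C : ℝ≥0∞) * (A2 ω) ^ 2 * ENNReal.ofReal (len q) := by
  refine ⟨1, fun ω hω hA q => ?_⟩
  set Q := (A2 ω).toReal with hQ
  let b : ℤ × ℤ → ℝ := fun p => Q * len p * Real.log (avg (invSqrtw ω) p ^ 2 * avg ω p)
  have hQ0 : 0 ≤ Q := ENNReal.toReal_nonneg
  have hb (p : ℤ × ℤ) : 0 ≤ b p :=
    mul_nonneg (mul_nonneg hQ0 (len_pos p).le)
      (Real.log_nonneg (hω.one_le_sq_avg_invSqrtw_mul_avg p))
  refine (tsum_dyad_subset_le (F := fun p =>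
    ENNReal.ofReal ((haarCoeff (invSqrtw ω) p) ^ 2 * avg ω p))
    (B := fun p => ENNReal.ofReal (b p)) (fun p => ?_) q).trans ?_
  · rw [← ENNReal.ofReal_add (hb _) (hb _), ← ENNReal.ofReal_add
      (mul_nonneg (sq_nonneg _) (hω.avg_weight_pos p).le) (add_nonneg (hb _) (hb _))]
    exact ENNReal.ofReal_le_ofReal (hω.haarCoeff_sq_mul_avg_add_le hA p)
  · rw [← ENNReal.ofReal_toReal hA.ne, ← hQ, ENNReal.coe_one, one_mul,
      ← ENNReal.ofReal_pow hQ0, ← ENNReal.ofReal_mul (by positivity)]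
    refine ENNReal.ofReal_le_ofReal ?_
    have h1 := hω.one_le_sq_avg_invSqrtw_mul_avg q
    have h2 := Real.log_le_sub_one_of_pos (zero_lt_one.trans_le h1)
    have h3 := hω.sq_avg_invSqrtw_mul_avg_le hA q
    calc b q ≤ Q * len q * Q :=
          mul_le_mul_of_nonneg_left (by linarith) (mul_nonneg hQ0 (len_pos q).le)
      _ = Q ^ 2 * len q := by ring
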